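/- The union 𝒲 of all distinguished subsets of OT_N is itself a distinguished set; hence 𝒲 is the maximal distinguished set. -/

import Mathlib

open scoped Classical

namespace ArOT

/-- An axiomatic presentation of Arai's computable notation system `OT_N` of ordinal terms
over the symbols `{0, S, +, φ, Ω, ψ}` (Definition 2.17 of the paper), with its subset
`Ψ_N` of collapsing terms below `S` and its term-comparison order `<`.
`Term` is the type of terms of `OT_N`, generated (cf. the field `ind`) by the term
constructors; `Fn` is the type of the attached irreducible finite functions `f`,
and `Kf f` is the finite set `K(f)` of components of `f`. -/
structure OTCtx (N : ℕ) : Type 1 where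
  /-- the terms of `OT_N` -/
  Term : Type
  /-- the term-comparison order of Proposition 2.13 / 2.19 -/
  lt : Term → Term → Prop
  lt_trans : ∀ {a b c : Term}, lt a b → lt b c → lt a c
  lt_irrefl : ∀ a : Term, ¬ lt a a
  lt_trich : ∀ a b : Term, lt a b ∨ a = b ∨ lt b a
  /-- the term `0` -/
  zero : Term
  /-- the term `Ω₁` -/
  om1 : Term
  /-- the term `S` (the stable ordinal `𝕊`) -/
  SS : Term
  /-- the terms `Ω_{S+n}` for `0 < n ≤ N` -/
  omS : ℕ → Term
  /-- (normal-form) sums -/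
  add : Term → Term → Term
  /-- Veblen terms `φβγ` -/
  phi : Term → Term → Term
  /-- the terms `Ω_{κ+n}` for `κ ∈ Ψ_N`, `0 < n ≤ N` -/
  omP : Term → ℕ → Term
  /-- the finite functions attached to collapsing terms -/
  Fn : Type
  /-- `K(f)`, the set of components of a finite function `f` -/
  Kf : Fn → Set Term
  /-- the collapsing terms `ψ_π^f(a)`: `psi π f a` -/
  psi : Term → Fn → Term → Term
  /-- `Ψ_N`: the set of collapsing terms below `S` -/
  Psi : Set Term
  /-- the terms of the form `Ω_{a+1}` -/
  IsOmSucc : Set Term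
  omSucc_om1 : om1 ∈ IsOmSucc
  omSucc_omS : ∀ n : ℕ, omS n ∈ IsOmSucc
  omSucc_omP : ∀ (κ : Term) (n : ℕ), omP κ n ∈ IsOmSucc
  zero_lt : ∀ t : Term, t ≠ zero → lt zero t
  Psi_lt_SS : ∀ σ ∈ Psi, lt σ SS
  psi_mem_Psi : ∀ (π : Term) (f : Fn) (a : Term), π ∈ Psi ∪ {SS} → psi π f a ∈ Psi
  /-- every term of `OT_N` is generated by the term constructors -/
  ind : ∀ P : Term → Prop,
    P zero → P om1 → P SS →
    (∀ n : ℕ, 0 < n → n ≤ N → P (omS n)) →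
    (∀ x y, P x → P y → P (add x y)) →
    (∀ x y, P x → P y → P (phi x y)) →
    (∀ (κ : Term) (n : ℕ), κ ∈ Psi → 0 < n → n ≤ N → P κ → P (omP κ n)) →
    (∀ (π : Term) (f : Fn) (a : Term), P π → P a → (∀ x ∈ Kf f, P x) → P (psi π f a)) →
    ∀ t : Term, P t

variable {N : ℕ}

/-- `x < α⁺`, where `α⁺` is the least term of the form `Ω_{a+1}` above `α`
(and `α⁺ = ∞` if there is none): `x` is below every such term above `α`. -/
def ltP (S : OTCtx N) (α x : S.Term) : Prop :=
  ∀ β, β ∈ S.IsOmSucc → S.lt α β → S.lt x β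

/-- Membership in the set `C^α(X)`: the closure of
`{0, Ω₁, S} ∪ {Ω_{S+n} : 0 < n ≤ N} ∪ (X ∩ α)` under `+`, `σ ↦ Ω_{σ+n}` (`σ ∈ Ψ_N`),
`(β,γ) ↦ φβγ`, and `(σ,β,f) ↦ ψ_σ^f(β)` for `σ > α` (Definition 3.1 of the paper). -/
inductive CMem (S : OTCtx N) (α : S.Term) (X : Set S.Term) : S.Term → Prop
  | zero : CMem S α X S.zero
  | om1 : CMem S α X S.om1
  | SS : CMem S α X S.SS
  | omS (n : ℕ) : 0 < n → n ≤ N → CMem S α X (S.omS n)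
  | ofX (x : S.Term) : x ∈ X → S.lt x α → CMem S α X x
  | add (x y : S.Term) : CMem S α X x → CMem S α X y → CMem S α X (S.add x y)
  | phi (x y : S.Term) : CMem S α X x → CMem S α X y → CMem S α X (S.phi x y)
  | omP (σ : S.Term) (n : ℕ) : σ ∈ S.Psi → 0 < n → n ≤ N → CMem S α X σ →
      CMem S α X (S.omP σ n)
  | psi (σ : S.Term) (f : S.Fn) (β : S.Term) : S.lt α σ → CMem S α X σ → CMem S α X β →
      (∀ x ∈ S.Kf f, CMem S α X x) → CMem S α X (S.psi σ f β)

/-- The set `C^α(X)`. -/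
def Cset (S : OTCtx N) (α : S.Term) (X : Set S.Term) : Set S.Term := {x | CMem S α X x}

/-- The well-founded part `W(X)` of `X` with respect to `<`. -/
def Wpart (S : OTCtx N) (X : Set S.Term) : Set S.Term :=
  {x | x ∈ X ∧ Acc (fun a b : S.Term => S.lt a b ∧ a ∈ X ∧ b ∈ X) x}

/-- `α ≤ X`: `α ≤ γ` for some `γ ∈ X`. -/
def leSome (S : OTCtx N) (α : S.Term) (X : Set S.Term) : Prop :=
  ∃ γ ∈ X, S.lt α γ ∨ α = γ

/-- `X` is a distinguished set, `D[X]` (Definition 3.4):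
`∀α (α ≤ X → W(C^α(X)) ∩ α⁺ = X ∩ α⁺)`. -/
def Dst (S : OTCtx N) (X : Set S.Term) : Prop :=
  ∀ α, leSome S α X →
    Wpart S (Cset S α X) ∩ {x | ltP S α x} = X ∩ {x | ltP S α x}

/-- `𝒲`, the union of all distinguished sets. -/
def maxW (S : OTCtx N) : Set S.Term := {x | ∃ X, Dst S X ∧ x ∈ X}

/-- `𝒢 = {α ∈ OT_N : α ∈ C^α(𝒲) ∧ C^α(𝒲) ∩ α ⊆ 𝒲}` (Definition 3.9). -/
def calG (S : OTCtx N) : Set S.Term :=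
  {α | CMem S α (maxW S) α ∧ ∀ x, CMem S α (maxW S) x → S.lt x α → x ∈ maxW S}

/-- `π ≺ κ`: the transitive closure of `{(π,κ) : π = ψ_κ^f(b)}` (Definition 3.7). -/
def prec (S : OTCtx N) : S.Term → S.Term → Prop :=
  Relation.TransGen fun π κ => ∃ (f : S.Fn) (b : S.Term), π = S.psi κ f b


/-- A distinguished set is well-founded. -/
theorem Dst.wellFoundedOn {S : OTCtx N} {X : Set S.Term} (hX : Dst S X) :
    X.WellFoundedOn S.lt := by
  rw [Set.wellFoundedOn_iff]
  have key : ∀ α ∈ X, Acc (fun a b => S.lt a b ∧ a ∈ X ∧ b ∈ X) α := by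
    intro α hα
    have heq := hX α ⟨α, hα, Or.inr rfl⟩
    have hsub : ∀ y ∈ X, ltP S α y → y ∈ Wpart S (Cset S α X) := fun y hy hlt =>
      (heq.symm ▸ ⟨hy, hlt⟩ : y ∈ Wpart S (Cset S α X) ∩ {x | ltP S α x}).1
    have hself : ltP S α α := fun _ _ h => h
    have aux : ∀ x, Acc (fun a b => S.lt a b ∧ a ∈ Cset S α X ∧ b ∈ Cset S α X) x →
        x ∈ X → ltP S α x → Acc (fun a b => S.lt a b ∧ a ∈ X ∧ b ∈ X) x := by
      intro x hacc
      induction hacc with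
      | intro x _ ih =>
        intro hx hlt
        refine Acc.intro x fun y hy => ?_
        have hyα : ltP S α y := fun β hβ hαβ => S.lt_trans hy.1 (hlt β hβ hαβ)
        exact ih y ⟨hy.1, (hsub y hy.2.1 hyα).1, (hsub x hx hlt).1⟩ hy.2.1 hyα
    exact aux α (hsub α hα hself).2 hα hself
  exact ⟨fun x => Acc.intro x fun y hy => key y hy.2.1⟩

/-- `C^α(X)` depends only on `X ∩ α`. -/
theorem Cset_congr {S : OTCtx N} {α : S.Term} {X Y : Set S.Term}
    (h : ∀ x, S.lt x α → (x ∈ X ↔ x ∈ Y)) : Cset S α X = Cset S α Y := by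
  have mono : ∀ {X Y : Set S.Term}, (∀ x, S.lt x α → x ∈ X → x ∈ Y) →
      ∀ x, CMem S α X x → CMem S α Y x := by
    intro X Y hXY x hx
    induction hx with
    | zero => exact .zero
    | om1 => exact .om1
    | SS => exact .SS
    | omS n h0 hn => exact .omS n h0 hn
    | ofX x hx hlt => exact .ofX x (hXY x hlt hx) hlt
    | add x y _ _ ihx ihy => exact .add x y ihx ihy
    | phi x y _ _ ihx ihy => exact .phi x y ihx ihy
    | omP σ n hσ h0 hn _ ih => exact .omP σ n hσ h0 hn ih
    | psi σ f β hlt _ _ _ ihσ ihβ ihf => exact .psi σ f β hlt ihσ ihβ ihf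
  exact Set.ext fun x => ⟨mono (fun y hy => (h y hy).1) x, mono (fun y hy => (h y hy).2) x⟩

/-- Distinguished sets that agree below `α` agree below `α⁺`, as long as both reach `α`. -/
theorem Dst.inter_ltP_congr {S : OTCtx N} {X Y : Set S.Term} (hX : Dst S X) (hY : Dst S Y)
    {α : S.Term} (hαX : leSome S α X) (hαY : leSome S α Y)
    (h : ∀ x, S.lt x α → (x ∈ X ↔ x ∈ Y)) :
    X ∩ {x | ltP S α x} = Y ∩ {x | ltP S α x} := by
  rw [← hX α hαX, ← hY α hαY, Cset_congr h]

theorem leSome.of_lt {S : OTCtx N} {X : Set S.Term} {α β : S.Term} (h : leSome S α X)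
    (hβ : S.lt β α) : leSome S β X := by
  obtain ⟨γ, hγ, hlt | rfl⟩ := h
  · exact ⟨γ, hγ, Or.inl (S.lt_trans hβ hlt)⟩
  · exact ⟨α, hγ, Or.inl hβ⟩

/-- Two distinguished sets have the same elements among the terms that both of them reach. -/
theorem Dst.mem_iff {S : OTCtx N} {X Y : Set S.Term} (hX : Dst S X) (hY : Dst S Y)
    {δ : S.Term} (hδX : leSome S δ X) (hδY : leSome S δ Y) : δ ∈ X ↔ δ ∈ Y := by
  have : IsStrictOrder S.Term S.lt :=
    { irrefl := S.lt_irrefl, trans := fun _ _ _ => S.lt_trans }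
  have hwf := hX.wellFoundedOn.union hY.wellFoundedOn
  have main : ∀ δ ∈ X ∪ Y, leSome S δ X → leSome S δ Y → (δ ∈ X ↔ δ ∈ Y) := by
    intro δ hδ
    refine hwf.induction (P := fun δ => leSome S δ X → leSome S δ Y → (δ ∈ X ↔ δ ∈ Y)) hδ
      fun δ _ ih hδX hδY => ?_
    have heq := hX.inter_ltP_congr hY hδX hδY fun x hx => by
      by_cases hmem : x ∈ X ∪ Y
      · exact ih x hmem hx (hδX.of_lt hx) (hδY.of_lt hx)
      · exact ⟨fun h => (hmem (Or.inl h)).elim, fun h => (hmem (Or.inr h)).elim⟩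
    have hself : ltP S δ δ := fun _ _ h => h
    exact ⟨fun h => (heq ▸ ⟨h, hself⟩ : δ ∈ Y ∩ {x | ltP S δ x}).1,
      fun h => (heq.symm ▸ ⟨h, hself⟩ : δ ∈ X ∩ {x | ltP S δ x}).1⟩
  exact ⟨fun h => (main δ (Or.inl h) hδX hδY).1 h, fun h => (main δ (Or.inr h) hδX hδY).2 h⟩

/-- A distinguished set that reaches `α` agrees with the union `𝒲` below `α⁺`. -/
theorem Dst.mem_maxW_iff {S : OTCtx N} {X : Set S.Term} (hX : Dst S X) {α δ : S.Term}
    (hα : leSome S α X) (hδ : ltP S α δ) : δ ∈ maxW S ↔ δ ∈ X := by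
  refine ⟨?_, fun h => ⟨X, hX, h⟩⟩
  rintro ⟨Y, hY, hδY⟩
  have hYδ : leSome S δ Y := ⟨δ, hδY, Or.inr rfl⟩
  rcases S.lt_trich δ α with hlt | rfl | hlt
  · exact (hX.mem_iff hY (hα.of_lt hlt) hYδ).2 hδY
  · exact (hX.mem_iff hY hα hYδ).2 hδY
  · have hαY := hYδ.of_lt hlt
    have heq := hX.inter_ltP_congr hY hα hαY fun x hx =>
      hX.mem_iff hY (hα.of_lt hx) (hαY.of_lt hx)
    exact (heq.symm ▸ ⟨hδY, hδ⟩ : δ ∈ X ∩ {x | ltP S α x}).1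

/-- Proposition 3.7: the union `𝒲` of all distinguished sets is itself distinguished,
hence it is the maximal distinguished set. -/
theorem stmt16 {N : ℕ} (S : OTCtx N) :
    Dst S (maxW S) ∧ ∀ X : Set S.Term, Dst S X → X ⊆ maxW S := by
  refine ⟨?_, fun X hX x hx => ⟨X, hX, hx⟩⟩
  rintro α ⟨γ, ⟨X, hX, hγ⟩, hle⟩
  have hα : leSome S α X := ⟨γ, hγ, hle⟩
  have hC : Cset S α (maxW S) = Cset S α X := Cset_congr fun x hx =>
    hX.mem_maxW_iff hα fun β _ hαβ => S.lt_trans hx hαβ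
  rw [hC, hX α hα]
  exact Set.ext fun x => and_congr_left fun hx => (hX.mem_maxW_iff hα hx).symm

end ArOT
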